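/- Let r ≥ d. Then for every n ≥ 1 and every a ∈ 𝕀_n^d, there exist b ∈ 𝕀_{2r+1}^d and a k-linear isomorphism V(a, n) → V(b, 2r+1) intertwining the respective operators T_0, …, T_{d−1}; that is, the ℋ^B_{Q,q}(d)-module V(a, n) is isomorphic to V(b, 2r+1). -/

import Mathlib

noncomputable section
namespace QSP

variable {k : Type*} [Field k]

/-- Doubled value of a basis index: `val n j = 2*j - (n-1)`, so that the basis
indices of `V_n` are the integers/half-integers `val/2` in `𝕀_n`. -/
def val (n : ℕ) (j : Fin n) : ℤ := 2 * (j : ℤ) - ((n : ℤ) - 1)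

/-- Matrix of the operator `K_Q` on `V_n` in the standard basis. -/
def KQmat (Q : k) (n : ℕ) : Matrix (Fin n) (Fin n) k := fun c b =>
  if val n b = 0 then (if c = b then Q⁻¹ else 0)
  else (if c = Fin.rev b then 1 else 0) + (if val n b < 0 ∧ c = b then Q⁻¹ - Q else 0)

/-- Matrix of the operator `R_q` on `V_n ⊗ V_n` in the standard basis. -/
def Rmat (q : k) (n : ℕ) : Matrix (Fin n × Fin n) (Fin n × Fin n) k := fun c b =>
  if b.1 = b.2 then (if c = b then q⁻¹ else 0)
  else if b.1 < b.2 then (if c = (b.2, b.1) then 1 else 0)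
  else (if c = (b.2, b.1) then 1 else 0) + (if c = b then q⁻¹ - q else 0)

/-- The operators `T_i`, `0 ≤ i ≤ d-1`, on `V_n^{⊗ d}`; `T_0` acts as `K_Q` on the
first tensor factor, and `T_i` (for `i > 0`) acts as `R_q` on the `(i, i+1)`
tensor factors (1-based). -/
def TB (Q q : k) (n d : ℕ) (i : ℕ) : Module.End k ((Fin d → Fin n) → k) :=
  if _h0 : i = 0 then
    if hd : 0 < d then
      Matrix.toLin' (fun c b =>
        if ∀ j, j ≠ (⟨0, hd⟩ : Fin d) → c j = b j then
          KQmat Q n (c ⟨0, hd⟩) (b ⟨0, hd⟩) else 0)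
    else 0
  else if hi : i < d then
    Matrix.toLin' (fun c b =>
      if ∀ j, j ≠ (⟨i - 1, Nat.lt_of_le_of_lt (Nat.pred_le i) hi⟩ : Fin d) →
          j ≠ (⟨i, hi⟩ : Fin d) → c j = b j then
        Rmat q n (c ⟨i - 1, Nat.lt_of_le_of_lt (Nat.pred_le i) hi⟩, c ⟨i, hi⟩)
          (b ⟨i - 1, Nat.lt_of_le_of_lt (Nat.pred_le i) hi⟩, b ⟨i, hi⟩) else 0)
  else 0

/-- The Jucys–Murphy elements `K_i = T_{i-1} ⋯ T_1 T_0 T_1 ⋯ T_{i-1}` acting on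
`V_n^{⊗ d}`, for `1 ≤ i ≤ d` (junk value `1` for `i = 0`). -/
def JM (Q q : k) (n d : ℕ) : ℕ → Module.End k ((Fin d → Fin n) → k)
  | 0 => 1
  | 1 => TB Q q n d 0
  | i + 2 => TB Q q n d (i + 1) * JM Q q n d (i + 1) * TB Q q n d (i + 1)

/-- The element `c_K = K_1 K_2 ⋯ K_d` acting on `V_n^{⊗ d}`. -/
def cK (Q q : k) (n d : ℕ) : Module.End k ((Fin d → Fin n) → k) :=
  ((List.range d).map (fun i => JM Q q n d (i + 1))).prod


/-- Generator `s_i` of the Weyl group `W^B(d)` acting on index tuples: `s_0`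
negates (reverses) the first entry, and `s_i` (`i > 0`) swaps entries `i` and
`i+1` (1-based), i.e. positions `i-1` and `i` (0-based). -/
def gAct {n d : ℕ} (i : Fin d) (x : Fin d → Fin n) : Fin d → Fin n :=
  if (i : ℕ) = 0 then Function.update x i (Fin.rev (x i))
  else x ∘ Equiv.swap (⟨(i : ℕ) - 1, Nat.lt_of_le_of_lt (Nat.pred_le _) i.isLt⟩ : Fin d) i

/-- Action of a word in the generators `s_0, …, s_{d-1}` on index tuples. -/
def wAct {n d : ℕ} : List (Fin d) → (Fin d → Fin n) → (Fin d → Fin n)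
  | [], x => x
  | i :: u, x => gAct i (wAct u x)

/-- The orbit of a tuple `a ∈ 𝕀_n^d` under the Weyl group `W^B(d)`. -/
def orbitB {n d : ℕ} (a : Fin d → Fin n) : Set (Fin d → Fin n) :=
  {b | ∃ u : List (Fin d), wAct u a = b}

/-- The permutation module `V(a, n) ⊆ V_n^{⊗d}`: the span of the standard basis
vectors `v_{wa}` for `w ∈ W^B(d)`. -/
def permMod (k : Type*) [Field k] {n d : ℕ} (a : Fin d → Fin n) :
    Submodule k ((Fin d → Fin n) → k) :=
  Submodule.span k ((fun b => Pi.single b (1 : k)) '' orbitB a)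

/-- Two submodules `U ⊆ V_m^{⊗d}` and `W ⊆ V_{m'}^{⊗d}` are isomorphic as
`ℋ^B_{Q,q}(d)`-modules: both are invariant under the operators `T_0, …, T_{d-1}`
and there is a `k`-linear isomorphism between them intertwining these
operators. -/
def heckeIso (Q q : k) (d m m' : ℕ)
    (U : Submodule k ((Fin d → Fin m) → k)) (W : Submodule k ((Fin d → Fin m') → k)) : Prop :=
  ∃ e : U ≃ₗ[k] W,
    ∀ i < d,
      (∀ x ∈ U, TB Q q m d i x ∈ U) ∧ (∀ y ∈ W, TB Q q m' d i y ∈ W) ∧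
      ∀ (x : (Fin d → Fin m) → k) (hx : x ∈ U) (hTx : TB Q q m d i x ∈ U),
        (e ⟨TB Q q m d i x, hTx⟩ : (Fin d → Fin m') → k) = TB Q q m' d i (e ⟨x, hx⟩)

lemma val_rev (n : ℕ) (x : Fin n) : val n (Fin.rev x) = - val n x := by
  have := x.isLt
  simp only [val, Fin.val_rev]
  omega

lemma val_lt (n : ℕ) (x y : Fin n) : val n x < val n y ↔ x < y := by
  simp only [val, Fin.lt_def]
  omega

lemma val_inj (n : ℕ) {x y : Fin n} (h : val n x = val n y) : x = y := by
  simp only [val] at h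
  ext
  omega

def pset {n d : ℕ} (a : Fin d → Fin n) : Finset ℤ :=
  (Finset.univ.image (fun j => |val n (a j)|)).filter (fun z => z ≠ 0)

def cnt {n d : ℕ} (a : Fin d → Fin n) (z : ℤ) : ℕ :=
  ((pset a).filter (fun p => p ≤ |z|)).card

def gfun {n d : ℕ} (a : Fin d → Fin n) (z : ℤ) : ℤ :=
  if z = 0 then 0 else if 0 < z then (cnt a z : ℤ) else - (cnt a z : ℤ)

lemma cnt_le {n d : ℕ} (a : Fin d → Fin n) (z : ℤ) : cnt a z ≤ d := by
  unfold cnt pset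
  refine (Finset.card_filter_le _ _).trans ((Finset.card_filter_le _ _).trans ?_)
  exact Finset.card_image_le.trans (by simp)

lemma cnt_neg {n d : ℕ} (a : Fin d → Fin n) (z : ℤ) : cnt a (-z) = cnt a z := by
  simp [cnt]

lemma gfun_neg {n d : ℕ} (a : Fin d → Fin n) (z : ℤ) : gfun a (-z) = - gfun a z := by
  unfold gfun
  rw [cnt_neg]
  split_ifs <;> omega

lemma gfun_bd {n d : ℕ} (a : Fin d → Fin n) (z : ℤ) : -(d:ℤ) ≤ gfun a z ∧ gfun a z ≤ d := by
  have := cnt_le a z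
  unfold gfun
  split_ifs <;> omega

def good {n d : ℕ} (a : Fin d → Fin n) (z : ℤ) : Prop := ∃ j, |z| = |val n (a j)|

lemma good_mem {n d : ℕ} {a : Fin d → Fin n} {z : ℤ} (h : good a z) (h0 : z ≠ 0) :
    |z| ∈ pset a := by
  obtain ⟨j, hj⟩ := h
  simp only [pset, Finset.mem_filter, Finset.mem_image, Finset.mem_univ, true_and]
  exact ⟨⟨j, hj.symm⟩, by simpa using h0⟩

lemma cnt_pos {n d : ℕ} {a : Fin d → Fin n} {z : ℤ} (h : good a z) (h0 : z ≠ 0) :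
    0 < cnt a z :=
  Finset.card_pos.mpr ⟨|z|, Finset.mem_filter.mpr ⟨good_mem h h0, le_rfl⟩⟩

lemma cnt_lt {n d : ℕ} {a : Fin d → Fin n} {z w : ℤ} (h : good a w) (hw : |z| < |w|) :
    cnt a z < cnt a w := by
  have h0 : w ≠ 0 := by
    rintro rfl
    have := abs_nonneg z
    simp at hw
    omega
  apply Finset.card_lt_card
  refine ⟨fun p hp => ?_, fun hs => ?_⟩
  · rw [Finset.mem_filter] at hp ⊢
    exact ⟨hp.1, hp.2.trans hw.le⟩
  · have := hs (Finset.mem_filter.mpr ⟨good_mem h h0, le_rfl⟩)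
    rw [Finset.mem_filter] at this
    omega

lemma gfun_lt {n d : ℕ} {a : Fin d → Fin n} {z w : ℤ} (hz : good a z) (hw : good a w)
    (h : z < w) : gfun a z < gfun a w := by
  have h1 : z ≠ 0 → 0 < cnt a z := cnt_pos hz
  have h2 : w ≠ 0 → 0 < cnt a w := cnt_pos hw
  have h3 : |z| < |w| → cnt a z < cnt a w := cnt_lt hw
  have h4 : |w| < |z| → cnt a w < cnt a z := cnt_lt hz
  unfold gfun
  rcases lt_trichotomy z 0 with hz0 | hz0 | hz0 <;> rcases lt_trichotomy w 0 with hw0 | hw0 | hw0 <;>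
    simp only [abs_of_neg, abs_of_pos, hz0, hw0] at h3 h4 <;> split_ifs <;> omega

def phi {n d : ℕ} (a : Fin d → Fin n) (r : ℕ) (hr : d ≤ r) (x : Fin n) : Fin (2 * r + 1) :=
  ⟨((r : ℤ) + gfun a (val n x)).toNat, by have := gfun_bd a (val n x); omega⟩

lemma val_phi {n d : ℕ} (a : Fin d → Fin n) (r : ℕ) (hr : d ≤ r) (x : Fin n) :
    val _ (phi a r hr x) = 2 * gfun a (val n x) := by
  have := gfun_bd a (val n x)
  have h2 : ((phi a r hr x : ℕ) : ℤ) = (r : ℤ) + gfun a (val n x) := by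
    simp only [phi]
    omega
  rw [val, h2]
  push_cast
  ring

lemma phi_rev {n d : ℕ} (a : Fin d → Fin n) (r : ℕ) (hr : d ≤ r) (x : Fin n) :
    phi a r hr (Fin.rev x) = Fin.rev (phi a r hr x) := by
  apply val_inj
  rw [val_rev, val_phi, val_phi, val_rev, gfun_neg]
  ring

lemma phi_lt {n d : ℕ} (a : Fin d → Fin n) (r : ℕ) (hr : d ≤ r) {x y : Fin n}
    (hx : good a (val n x)) (hy : good a (val n y)) (h : x < y) :
    phi a r hr x < phi a r hr y := by
  rw [← val_lt] at h ⊢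
  rw [val_phi, val_phi]
  have := gfun_lt hx hy h
  omega

lemma phi_lt_iff {n d : ℕ} (a : Fin d → Fin n) (r : ℕ) (hr : d ≤ r) {x y : Fin n}
    (hx : good a (val n x)) (hy : good a (val n y)) :
    phi a r hr x < phi a r hr y ↔ x < y := by
  refine ⟨fun h => ?_, phi_lt a r hr hx hy⟩
  rcases lt_trichotomy x y with h1 | h1 | h1
  · exact h1
  · subst h1; exact absurd h (lt_irrefl _)
  · exact absurd h (phi_lt a r hr hy hx h1).asymm

lemma phi_inj {n d : ℕ} (a : Fin d → Fin n) (r : ℕ) (hr : d ≤ r) {x y : Fin n}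
    (hx : good a (val n x)) (hy : good a (val n y)) :
    phi a r hr x = phi a r hr y ↔ x = y := by
  refine ⟨fun h => ?_, fun h => by rw [h]⟩
  rcases lt_trichotomy x y with h1 | h1 | h1
  · exact absurd h (phi_lt a r hr hx hy h1).ne
  · exact h1
  · exact absurd h (phi_lt a r hr hy hx h1).ne'

lemma gfun_zero_iff {n d : ℕ} {a : Fin d → Fin n} {z : ℤ} (hz : good a z) :
    gfun a z = 0 ↔ z = 0 := by
  have h1 : z ≠ 0 → 0 < cnt a z := cnt_pos hz
  unfold gfun
  split_ifs <;> omega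

lemma gfun_neg_iff {n d : ℕ} {a : Fin d → Fin n} {z : ℤ} (hz : good a z) :
    gfun a z < 0 ↔ z < 0 := by
  have h1 : z ≠ 0 → 0 < cnt a z := cnt_pos hz
  unfold gfun
  split_ifs <;> omega

lemma gAct_good {n d : ℕ} {a : Fin d → Fin n} (i : Fin d) {x : Fin d → Fin n}
    (hx : ∀ j, good a (val n (x j))) (j : Fin d) : good a (val n (gAct i x j)) := by
  unfold gAct
  split_ifs with h
  · by_cases hj : j = i
    · subst hj
      obtain ⟨l, hl⟩ := hx j
      refine ⟨l, ?_⟩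
      rw [Function.update_self, val_rev, abs_neg, hl]
    · rw [Function.update_of_ne hj]; exact hx j
  · exact hx _

lemma orbit_good {n d : ℕ} {a x : Fin d → Fin n} (hx : x ∈ orbitB a) (j : Fin d) :
    good a (val n (x j)) := by
  obtain ⟨u, rfl⟩ := hx
  induction u generalizing j with
  | nil => exact ⟨j, rfl⟩
  | cons i u ih => exact gAct_good i ih j

lemma gAct_orbit {n d : ℕ} {a x : Fin d → Fin n} (i : Fin d) (hx : x ∈ orbitB a) :
    gAct i x ∈ orbitB a := by
  obtain ⟨u, rfl⟩ := hx
  exact ⟨i :: u, rfl⟩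

lemma gAct_phi {n d : ℕ} (a : Fin d → Fin n) (r : ℕ) (hr : d ≤ r) (i : Fin d)
    (x : Fin d → Fin n) : gAct i (phi a r hr ∘ x) = phi a r hr ∘ gAct i x := by
  unfold gAct
  split_ifs with h
  · rw [Function.comp_update, phi_rev]; rfl
  · rfl

lemma wAct_phi {n d : ℕ} (a : Fin d → Fin n) (r : ℕ) (hr : d ≤ r) (u : List (Fin d))
    (x : Fin d → Fin n) : wAct u (phi a r hr ∘ x) = phi a r hr ∘ wAct u x := by
  induction u with
  | nil => rfl
  | cons i u ih => simp only [wAct]; rw [ih, gAct_phi]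

lemma orbit_phi {n d : ℕ} (a : Fin d → Fin n) (r : ℕ) (hr : d ≤ r) :
    orbitB (phi a r hr ∘ a) = (fun x => phi a r hr ∘ x) '' orbitB a := by
  ext y
  constructor
  · rintro ⟨u, rfl⟩
    exact ⟨_, ⟨u, rfl⟩, (wAct_phi a r hr u a).symm⟩
  · rintro ⟨_, ⟨u, rfl⟩, rfl⟩
    exact ⟨u, wAct_phi a r hr u a⟩

def prd {d : ℕ} (i : Fin d) : Fin d :=
  ⟨(i : ℕ) - 1, Nat.lt_of_le_of_lt (Nat.pred_le _) i.isLt⟩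

def cA (Q q : k) {n d : ℕ} (i : Fin d) (c : Fin d → Fin n) : k :=
  if (i : ℕ) = 0 then
    (if val n (c i) = 0 then Q⁻¹ else if val n (c i) < 0 then Q⁻¹ - Q else 0)
  else
    (if c (prd i) = c i then q⁻¹ else if c (prd i) < c i then 0 else q⁻¹ - q)

def cB (k : Type*) [Field k] {n d : ℕ} (i : Fin d) (c : Fin d → Fin n) : k :=
  if (i : ℕ) = 0 then (if val n (c i) = 0 then 0 else 1)
  else (if c (prd i) = c i then 0 else 1)

lemma toLin_single {ι : Type*} [Fintype ι] [DecidableEq ι] (M : Matrix ι ι k) (c e : ι) :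
    Matrix.toLin' M (Pi.single c 1) e = M e c := by
  rw [Matrix.toLin'_apply, Matrix.mulVec_single_one]
  rfl

lemma TB_single (Q q : k) {n d : ℕ} (i : Fin d) (c : Fin d → Fin n) :
    TB Q q n d i (Pi.single c 1) =
      cA Q q i c • Pi.single c 1 + cB k i c • Pi.single (gAct i c) 1 := by
  ext e
  simp only [Pi.add_apply, Pi.smul_apply, Pi.single_apply, smul_eq_mul]
  by_cases h0 : (i : ℕ) = 0
  · have hd : 0 < d := i.pos
    have hi : i = ⟨0, hd⟩ := Fin.ext h0
    have e1 : (e = c) ↔ (∀ j, j ≠ i → e j = c j) ∧ e i = c i := by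
      constructor
      · rintro rfl; simp
      · rintro ⟨h1, h2⟩; ext1 j
        by_cases hj : j = i
        · rw [hj, h2]
        · exact h1 j hj
    have e2 : (e = gAct i c) ↔ (∀ j, j ≠ i → e j = c j) ∧ e i = Fin.rev (c i) := by
      simp only [gAct, h0, if_true]
      rw [Function.eq_update_iff]
      tauto
    have hM : TB Q q n d i (Pi.single c 1) e =
        if ∀ j, j ≠ i → e j = c j then KQmat Q n (e i) (c i) else 0 := by
      unfold TB
      rw [dif_pos h0, dif_pos hd]
      refine (toLin_single _ c e).trans ?_
      rw [hi]
    rw [hM]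
    unfold KQmat
    simp only [cA, cB, h0, if_true]
    by_cases hj : ∀ j, j ≠ i → e j = c j
    · rw [and_iff_right hj] at e1 e2
      rw [if_pos hj]
      simp only [e1, e2]
      clear e1 e2 hM hj
      split_ifs <;> first | (exfalso; tauto) | ring1 | grind
    · rw [if_neg hj, if_neg (fun h => hj (e1.1 h).1), if_neg (fun h => hj (e2.1 h).1)]; simp
  · have e1 : (e = c) ↔ (∀ j, j ≠ prd i → j ≠ i → e j = c j) ∧
        (e (prd i), e i) = (c (prd i), c i) := by
      constructor
      · rintro rfl; simp
      · rintro ⟨h1, h2⟩; ext1 j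
        rw [Prod.mk.injEq] at h2
        by_cases hj : j = i
        · rw [hj, h2.2]
        · by_cases hj' : j = prd i
          · rw [hj', h2.1]
          · exact h1 j hj' hj
    have e2 : (e = gAct i c) ↔ (∀ j, j ≠ prd i → j ≠ i → e j = c j) ∧
        (e (prd i), e i) = (c i, c (prd i)) := by
      have hg : gAct i c = c ∘ Equiv.swap (prd i) i := by
        simp only [gAct, h0, if_false]; rfl
      rw [hg]
      constructor
      · rintro rfl
        refine ⟨fun j h1 h2 => ?_, ?_⟩
        · simp [Equiv.swap_apply_of_ne_of_ne h1 h2]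
        · simp
      · rintro ⟨h1, h2⟩; ext1 j
        rw [Prod.mk.injEq] at h2
        by_cases hj : j = i
        · rw [hj, h2.2]; simp
        · by_cases hj' : j = prd i
          · rw [hj', h2.1]; simp
          · rw [h1 j hj' hj]; simp [Equiv.swap_apply_of_ne_of_ne hj' hj]
    have hM : TB Q q n d i (Pi.single c 1) e =
        if ∀ j, j ≠ prd i → j ≠ i → e j = c j then
          Rmat q n (e (prd i), e i) (c (prd i), c i) else 0 := by
      unfold TB
      rw [dif_neg h0, dif_pos i.isLt]
      exact (toLin_single _ c e).trans rfl
    rw [hM]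
    unfold Rmat
    simp only [cA, cB, h0, if_false]
    by_cases hj : ∀ j, j ≠ prd i → j ≠ i → e j = c j
    · rw [and_iff_right hj] at e1 e2
      rw [if_pos hj]
      simp only [e1, e2]
      clear e1 e2 hM hj
      split_ifs <;> first | (exfalso; tauto) | ring1 | grind
    · rw [if_neg hj, if_neg (fun h => hj (e1.1 h).1), if_neg (fun h => hj (e2.1 h).1)]; simp

lemma cA_phi (Q q : k) {n d : ℕ} (a : Fin d → Fin n) (r : ℕ) (hr : d ≤ r) (i : Fin d)
    {c : Fin d → Fin n} (hc : ∀ j, good a (val n (c j))) :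
    cA Q q i (phi a r hr ∘ c) = cA Q q i c := by
  have h1 : 2 * gfun a (val n (c i)) = 0 ↔ val n (c i) = 0 := by
    rw [← gfun_zero_iff (hc i)]; omega
  have h2 : 2 * gfun a (val n (c i)) < 0 ↔ val n (c i) < 0 := by
    rw [← gfun_neg_iff (hc i)]; omega
  simp only [cA, Function.comp_apply, val_phi, h1, h2, phi_inj a r hr (hc _) (hc _),
    phi_lt_iff a r hr (hc _) (hc _)]

lemma cB_phi {n d : ℕ} (a : Fin d → Fin n) (r : ℕ) (hr : d ≤ r) (i : Fin d)
    {c : Fin d → Fin n} (hc : ∀ j, good a (val n (c j))) :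
    cB k i (phi a r hr ∘ c) = cB k i c := by
  have h1 : 2 * gfun a (val n (c i)) = 0 ↔ val n (c i) = 0 := by
    rw [← gfun_zero_iff (hc i)]; omega
  simp only [cB, Function.comp_apply, val_phi, h1, phi_inj a r hr (hc _) (hc _)]

lemma TB_mem (Q q : k) {n d : ℕ} (a : Fin d → Fin n) (i : Fin d)
    (x : (Fin d → Fin n) → k) (hx : x ∈ permMod k a) : TB Q q n d i x ∈ permMod k a := by
  have : permMod k a ≤ (permMod k a).comap (TB Q q n d i) := by
    rw [permMod, Submodule.span_le]
    rintro _ ⟨c, hc, rfl⟩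
    simp only [Submodule.comap_coe, Set.mem_preimage, SetLike.mem_coe]
    rw [TB_single]
    exact Submodule.add_mem _
      (Submodule.smul_mem _ _ (Submodule.subset_span ⟨c, hc, rfl⟩))
      (Submodule.smul_mem _ _ (Submodule.subset_span ⟨_, gAct_orbit i hc, rfl⟩))
  exact this hx

def push (k : Type*) [Field k] {n m d : ℕ} (f : Fin n → Fin m) :
    ((Fin d → Fin n) → k) →ₗ[k] ((Fin d → Fin m) → k) :=
  Fintype.linearCombination k (fun c : Fin d → Fin n => (Pi.single (f ∘ c) (1 : k)))

lemma push_single {n m d : ℕ} (f : Fin n → Fin m) (c : Fin d → Fin n) :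
    push k f (Pi.single c 1) = Pi.single (f ∘ c) 1 := by
  rw [push, Fintype.linearCombination_apply_single, one_smul]

open Classical in
def pull (k : Type*) [Field k] {n m d : ℕ} (f : Fin n → Fin m) (S : Set (Fin d → Fin n)) :
    ((Fin d → Fin m) → k) →ₗ[k] ((Fin d → Fin n) → k) where
  toFun g := fun c => if c ∈ S then g (f ∘ c) else 0
  map_add' g h := by
    ext c
    simp only [Pi.add_apply]
    split_ifs <;> simp
  map_smul' t g := by
    ext c
    simp only [Pi.smul_apply, RingHom.id_apply]
    split_ifs <;> simp

lemma pull_push {n d : ℕ} (a : Fin d → Fin n) (r : ℕ) (hr : d ≤ r)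
    (x : (Fin d → Fin n) → k) (hx : x ∈ permMod k a) :
    pull k (phi a r hr) (orbitB a) (push k (phi a r hr) x) = x := by
  have : permMod k a ≤ LinearMap.eqLocus
      (pull k (phi a r hr) (orbitB a) ∘ₗ push k (phi a r hr)) LinearMap.id := by
    rw [permMod, Submodule.span_le]
    rintro _ ⟨c, hc, rfl⟩
    simp only [SetLike.mem_coe, LinearMap.mem_eqLocus, LinearMap.comp_apply, LinearMap.id_apply]
    rw [push_single]
    ext e
    simp only [pull, LinearMap.coe_mk, AddHom.coe_mk, Pi.single_apply]
    by_cases he : e ∈ orbitB a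
    · have : phi a r hr ∘ e = phi a r hr ∘ c ↔ e = c := by
        refine ⟨fun h => ?_, fun h => by rw [h]⟩
        ext1 j
        exact (phi_inj a r hr (orbit_good he j) (orbit_good hc j)).1 (congrFun h j)
      simp only [he, if_true, this]
    · have : e ≠ c := fun h => he (h ▸ hc)
      simp only [he, if_false, this]
  exact this hx

lemma push_TB (Q q : k) {n d : ℕ} (a : Fin d → Fin n) (r : ℕ) (hr : d ≤ r) (i : Fin d)
    (x : (Fin d → Fin n) → k) (hx : x ∈ permMod k a) :
    push k (phi a r hr) (TB Q q n d i x) =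
      TB Q q (2 * r + 1) d i (push k (phi a r hr) x) := by
  have : permMod k a ≤ LinearMap.eqLocus
      (push k (phi a r hr) ∘ₗ TB Q q n d i)
      (TB Q q (2 * r + 1) d i ∘ₗ push k (phi a r hr)) := by
    rw [permMod, Submodule.span_le]
    rintro _ ⟨c, hc, rfl⟩
    simp only [SetLike.mem_coe, LinearMap.mem_eqLocus, LinearMap.comp_apply]
    rw [push_single, TB_single, TB_single, map_add, map_smul, map_smul, push_single, push_single,
      cA_phi Q q a r hr i (orbit_good hc), cB_phi a r hr i (orbit_good hc), gAct_phi]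
  exact this hx

lemma push_map {n d : ℕ} (a : Fin d → Fin n) (r : ℕ) (hr : d ≤ r) :
    (permMod k a).map (push k (phi a r hr)) = permMod k (phi a r hr ∘ a) := by
  rw [permMod, permMod, Submodule.map_span, orbit_phi, Set.image_image, Set.image_image]
  simp only [push_single]

/-- Let `r ≥ d`.  For every `n ≥ 1` and every tuple
`a ∈ 𝕀_n^d`, the `ℋ^B_{Q,q}(d)`-module `V(a, n)` is isomorphic to
`V(b, 2r+1)` for some tuple `b ∈ 𝕀_{2r+1}^d`. -/
theorem permutation_module_stability
    (Q q : k) (hQ : Q ≠ 0) (hq : q ≠ 0) (d r : ℕ) (hd : 1 ≤ d) (hr : d ≤ r)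
    (n : ℕ) (hn : 1 ≤ n) (a : Fin d → Fin n) :
    ∃ b : Fin d → Fin (2 * r + 1),
      heckeIso Q q d n (2 * r + 1) (permMod k a) (permMod k b) := by
  refine ⟨phi a r hr ∘ a, ?_⟩
  have hinj : ∀ x ∈ permMod k a, ∀ y ∈ permMod k a,
      push k (phi a r hr) x = push k (phi a r hr) y → x = y := fun x hx y hy h => by
    rw [← pull_push a r hr x hx, h, pull_push a r hr y hy]
  have hmem : ∀ x ∈ permMod k a, push k (phi a r hr) x ∈ permMod k (phi a r hr ∘ a) :=
    fun x hx => push_map (k := k) a r hr ▸ Submodule.mem_map_of_mem hx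
  let e : permMod k a ≃ₗ[k] permMod k (phi a r hr ∘ a) :=
    LinearEquiv.ofBijective ((push k (phi a r hr)).restrict hmem) (by
      constructor
      · rintro ⟨x, hx⟩ ⟨y, hy⟩ h
        exact Subtype.ext (hinj x hx y hy (congrArg Subtype.val h))
      · rintro ⟨y, hy⟩
        obtain ⟨x, hx, rfl⟩ := Submodule.mem_map.1 ((push_map (k := k) a r hr).symm ▸ hy)
        exact ⟨⟨x, hx⟩, rfl⟩)
  refine ⟨e, fun i hi => ⟨fun x hx => TB_mem Q q a ⟨i, hi⟩ x hx,
    fun y hy => TB_mem Q q _ ⟨i, hi⟩ y hy, fun x hx hTx => ?_⟩⟩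
  exact push_TB Q q a r hr ⟨i, hi⟩ x hx

end QSP
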